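/- Whenever λ is interlaced under μ, the products of arrow generators along all directed paths from λ to μ in Γ coincide in F; denote this common element by (λ‖μ). The collection of all elements (λ‖μ), taken over all pairs with λ interlaced under μ, is a K-basis of F, and (λ‖μ)·(μ‖η) = (λ‖η) whenever λ is interlaced under μ, μ is interlaced under η, and λ is interlaced under η. -/

import Mathlib

/-- Partitions, encoded as weakly decreasing finitely supported sequences
`λ = (λ_1, λ_2, …)` of natural numbers (0-based: entry `i` is `λ_{i+1}`). -/
def Ptn : Type := {f : ℕ →₀ ℕ // ∀ i, f (i + 1) ≤ f i}

/-- The size `|λ|` of a partition. -/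
def ptnSize (l : Ptn) : ℕ := l.1.sum fun _ m => m

/-- The covering relation of the Young lattice: `λ ⊆ μ` and `|μ| = |λ| + 1`,
i.e. there is an arrow `λ → μ` in the quiver `Γ`. -/
def PCovers (l m : Ptn) : Prop := (∀ i, l.1 i ≤ m.1 i) ∧ ptnSize m = ptnSize l + 1

/-- `η∖λ` consists of two boxes in the same column, i.e. `η∖λ = (1²)`. -/
def SameColumn (l h : Ptn) : Prop :=
  ∃ i, h.1 i = l.1 i + 1 ∧ h.1 (i + 1) = l.1 (i + 1) + 1 ∧ l.1 i = l.1 (i + 1) ∧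
    ∀ r, r ≠ i → r ≠ i + 1 → h.1 r = l.1 r

/-- Generators of the quiver algebra `F`: an idempotent `(λ)` for each vertex and
a generator `(λ|μ)` for each arrow `λ → μ` of `Γ`. -/
inductive FGen : Type where
  | idem (l : Ptn)
  | arr (l m : Ptn)

variable (K : Type) [Field K] [CharZero K]

/-- The defining relations of the algebra `F`: the path algebra relations of the
quiver `Γ` together with the commuting-square relations
`(λ|μ)(μ|η) = (λ|ν)(ν|η)` and the relations `(λ|μ)(μ|η) = 0` when
`η∖λ = (1²)`. -/
inductive FRel : FreeAlgebra K FGen → FreeAlgebra K FGen → Prop where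
  | idem_sq (l : Ptn) :
      FRel (FreeAlgebra.ι K (FGen.idem l) * FreeAlgebra.ι K (FGen.idem l))
        (FreeAlgebra.ι K (FGen.idem l))
  | idem_orth (l m : Ptn) (h : l ≠ m) :
      FRel (FreeAlgebra.ι K (FGen.idem l) * FreeAlgebra.ι K (FGen.idem m)) 0
  | arr_not_cover (l m : Ptn) (h : ¬ PCovers l m) :
      FRel (FreeAlgebra.ι K (FGen.arr l m)) 0
  | idem_arr (l m : Ptn) :
      FRel (FreeAlgebra.ι K (FGen.idem l) * FreeAlgebra.ι K (FGen.arr l m))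
        (FreeAlgebra.ι K (FGen.arr l m))
  | idem_arr_ne (l m n : Ptn) (h : n ≠ l) :
      FRel (FreeAlgebra.ι K (FGen.idem n) * FreeAlgebra.ι K (FGen.arr l m)) 0
  | arr_idem (l m : Ptn) :
      FRel (FreeAlgebra.ι K (FGen.arr l m) * FreeAlgebra.ι K (FGen.idem m))
        (FreeAlgebra.ι K (FGen.arr l m))
  | arr_idem_ne (l m n : Ptn) (h : n ≠ m) :
      FRel (FreeAlgebra.ι K (FGen.arr l m) * FreeAlgebra.ι K (FGen.idem n)) 0
  | square (l m n e : Ptn) (h1 : PCovers l m) (h2 : PCovers l n) (h3 : PCovers m e)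
      (h4 : PCovers n e) (h : m ≠ n) :
      FRel (FreeAlgebra.ι K (FGen.arr l m) * FreeAlgebra.ι K (FGen.arr m e))
        (FreeAlgebra.ι K (FGen.arr l n) * FreeAlgebra.ι K (FGen.arr n e))
  | column (l m e : Ptn) (h1 : PCovers l m) (h2 : PCovers m e) (h : SameColumn l e) :
      FRel (FreeAlgebra.ι K (FGen.arr l m) * FreeAlgebra.ι K (FGen.arr m e)) 0

/-- The algebra `F`. -/
abbrev FAlg : Type := RingQuot (FRel K)

/-- The idempotent `(λ) ∈ F`. -/
def eP (l : Ptn) : FAlg K := RingQuot.mkAlgHom K (FRel K) (FreeAlgebra.ι K (FGen.idem l))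

/-- The arrow generator `(λ|μ) ∈ F`. -/
def aP (l m : Ptn) : FAlg K := RingQuot.mkAlgHom K (FRel K) (FreeAlgebra.ι K (FGen.arr l m))

/-- The component `(λ)F(μ) = (λ)·F·(μ)`. -/
def Fspace (l m : Ptn) : Submodule K (FAlg K) :=
  LinearMap.range ((LinearMap.mulLeft K (eP K l)).comp (LinearMap.mulRight K (eP K m)))

/-- `λ` is interlaced under `μ`: `μ_i ≥ λ_i ≥ μ_{i+1}` for all `i ≥ 1`. -/
def Interlaced (l m : Ptn) : Prop := ∀ i, l.1 i ≤ m.1 i ∧ m.1 (i + 1) ≤ l.1 i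

/-- The product in `F` of the arrow generators along the path
`l → p₀ → p₁ → ⋯` (an empty path contributes the idempotent `(l)`). -/
def prodAlong : Ptn → List Ptn → FAlg K
  | l, [] => eP K l
  | l, m :: rest => aP K l m * prodAlong m rest

/-- `p` is the list of successive vertices (after `l`) of a directed path in `Γ`
from `l` to `m`. -/
def IsPath (l m : Ptn) (p : List Ptn) : Prop :=
  List.Chain PCovers l p ∧ (l :: p).getLast (List.cons_ne_nil l p) = m

theorem Ptn.ext {l m : Ptn} (h : ∀ i, l.1 i = m.1 i) : l = m :=
  Subtype.ext (Finsupp.ext h)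

theorem ptnSize_eq_degree (l : Ptn) : ptnSize l = l.1.degree := rfl

theorem pCovers_iff {l m : Ptn} :
    PCovers l m ↔ ∃ i, m.1 i = l.1 i + 1 ∧ ∀ r, r ≠ i → m.1 r = l.1 r := by
  constructor
  · rintro ⟨hle, hs⟩
    have hadd : m.1 = l.1 + (m.1 - l.1) := by
      ext i
      have := hle i
      simp only [Finsupp.add_apply, Finsupp.tsub_apply]
      omega
    have hd : (m.1 - l.1).degree = 1 := by
      rw [ptnSize_eq_degree, ptnSize_eq_degree, hadd, map_add] at hs
      omega
    have hmem : m.1 - l.1 ∈ Set.range (fun a : ℕ => Finsupp.single a 1) := by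
      rw [Finsupp.range_single_one]
      exact hd
    obtain ⟨i, hi⟩ := hmem
    refine ⟨i, ?_, fun r hr => ?_⟩ <;> rw [hadd, ← hi]
    · simp
    · simp [hr.symm]
  · rintro ⟨i, hi, hr⟩
    have hadd : m.1 = l.1 + Finsupp.single i 1 := by
      ext r
      by_cases h : r = i
      · subst h; simpa using hi
      · simpa [Finsupp.single_apply, Ne.symm h] using hr r h
    refine ⟨fun r => by rw [hadd]; simp, ?_⟩
    rw [ptnSize_eq_degree, ptnSize_eq_degree, hadd, map_add, Finsupp.degree_single]

theorem exists_addBox (l : Ptn) (i : ℕ) (h : ∀ j, i = j + 1 → l.1 i < l.1 j) :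
    ∃ n : Ptn, n.1 i = l.1 i + 1 ∧ ∀ r, r ≠ i → n.1 r = l.1 r := by
  refine ⟨⟨l.1 + Finsupp.single i 1, fun r => ?_⟩, by simp, fun r hr => ?_⟩
  · have h1 := l.2 r
    have h2 := h r
    simp only [Finsupp.add_apply, Finsupp.single_apply]
    split_ifs <;> grind
  · simp [hr.symm]

theorem Interlaced.refl (l : Ptn) : Interlaced l l := fun i => ⟨le_rfl, l.2 i⟩

theorem Interlaced.right_of_le {l n m : Ptn} (h : Interlaced l m) (h1 : ∀ i, l.1 i ≤ n.1 i)
    (h2 : ∀ i, n.1 i ≤ m.1 i) : Interlaced n m :=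
  fun i => ⟨h2 i, (h i).2.trans (h1 i)⟩

theorem exists_diamond {l n n' m : Ptn} (h : PCovers l n) (h' : PCovers l n') (hne : n ≠ n')
    (hm : ∀ i, n.1 i ≤ m.1 i) (hm' : ∀ i, n'.1 i ≤ m.1 i) :
    ∃ e, PCovers n e ∧ PCovers n' e ∧ ∀ i, e.1 i ≤ m.1 i := by
  obtain ⟨i, hi, hri⟩ := pCovers_iff.1 h
  obtain ⟨j, hj, hrj⟩ := pCovers_iff.1 h'
  have hij : i ≠ j := by
    rintro rfl
    refine hne (Ptn.ext fun r => ?_)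
    by_cases hr : r = i
    · rw [hr, hi, hj]
    · rw [hri r hr, hrj r hr]
  obtain ⟨e, he, hre⟩ := exists_addBox n j (fun k hk => by
    have := n'.2 k
    grind)
  refine ⟨e, pCovers_iff.2 ⟨j, he, hre⟩, pCovers_iff.2 ⟨i, ?_, fun r hr => ?_⟩, fun r => ?_⟩
  · grind
  · by_cases hrj' : r = j <;> grind
  · have := hm r
    have := hm' r
    by_cases hrj' : r = j <;> grind

theorem isPath_nil {l m : Ptn} : IsPath l m [] ↔ l = m := by
  simp [IsPath, List.Chain]

theorem isPath_cons {l m n : Ptn} {p : List Ptn} :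
    IsPath l m (n :: p) ↔ PCovers l n ∧ IsPath n m p := by
  simp [IsPath, List.Chain, and_assoc]

theorem IsPath.append {l m e : Ptn} {p q : List Ptn} (hp : IsPath l m p) (hq : IsPath m e q) :
    IsPath l e (p ++ q) := by
  induction p generalizing l with
  | nil => rw [isPath_nil] at hp; subst hp; exact hq
  | cons n p ih =>
    rw [isPath_cons] at hp
    exact isPath_cons.2 ⟨hp.1, ih hp.2⟩

theorem IsPath.le {l m : Ptn} {p : List Ptn} (hp : IsPath l m p) (i : ℕ) :
    l.1 i ≤ m.1 i := by
  induction p generalizing l with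
  | nil => rw [isPath_nil] at hp; rw [hp]
  | cons n p ih =>
    rw [isPath_cons] at hp
    exact (hp.1.1 i).trans (ih hp.2)

theorem IsPath.ptnSize_eq {l m : Ptn} {p : List Ptn} (hp : IsPath l m p) :
    ptnSize m = ptnSize l + p.length := by
  induction p generalizing l with
  | nil => rw [isPath_nil] at hp; simp [hp]
  | cons n p ih =>
    rw [isPath_cons] at hp
    rw [ih hp.2, hp.1.2, List.length_cons]
    omega

theorem IsPath.length_eq {l m : Ptn} {p q : List Ptn} (hp : IsPath l m p) (hq : IsPath l m q) :
    p.length = q.length := by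
  have := hp.ptnSize_eq
  have := hq.ptnSize_eq
  omega

theorem ptnSize_mono {l m : Ptn} (h : ∀ i, l.1 i ≤ m.1 i) : ptnSize l ≤ ptnSize m :=
  Finsupp.degree_mono (R := ℕ) h

theorem Interlaced.exists_step {l m : Ptn} (h : Interlaced l m) {i : ℕ} (hi : l.1 i < m.1 i) :
    ∃ n : Ptn, (n.1 i = l.1 i + 1 ∧ ∀ r, r ≠ i → n.1 r = l.1 r) ∧ PCovers l n ∧
      Interlaced n m := by
  obtain ⟨n, hn⟩ := exists_addBox l i (fun j hj => by
    have := (h j).2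
    grind)
  have hc : PCovers l n := pCovers_iff.2 ⟨i, hn⟩
  refine ⟨n, hn, hc, h.right_of_le hc.1 fun r => ?_⟩
  have := (h r).1
  by_cases hr : r = i <;> grind

theorem Interlaced.exists_isPath {l m : Ptn} (h : Interlaced l m) : ∃ p, IsPath l m p := by
  induction hk : ptnSize m - ptnSize l using Nat.strong_induction_on generalizing l with
  | _ k ih =>
    by_cases hex : ∃ i, l.1 i < m.1 i
    · obtain ⟨i, hi⟩ := hex
      obtain ⟨n, -, hc, hn⟩ := h.exists_step hi
      have h1 := hc.2
      have h2 := ptnSize_mono fun r => (hn r).1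
      obtain ⟨p, hp⟩ := ih (ptnSize m - ptnSize n) (by omega) hn rfl
      exact ⟨n :: p, isPath_cons.2 ⟨hc, hp⟩⟩
    · push Not at hex
      exact ⟨[], isPath_nil.2 (Ptn.ext fun i => le_antisymm (h i).1 (hex i))⟩

section Algebra

variable {k : Type} [Field k]

theorem eP_mul_self (l : Ptn) : eP k l * eP k l = eP k l := by
  rw [eP, ← map_mul]
  exact RingQuot.mkAlgHom_rel k (FRel.idem_sq l)

theorem eP_mul_eP_of_ne {l m : Ptn} (h : l ≠ m) : eP k l * eP k m = 0 := by
  rw [eP, eP, ← map_mul, ← map_zero (RingQuot.mkAlgHom k (FRel k))]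
  exact RingQuot.mkAlgHom_rel k (FRel.idem_orth l m h)

theorem aP_of_not_pCovers {l m : Ptn} (h : ¬ PCovers l m) : aP k l m = 0 := by
  rw [aP, ← map_zero (RingQuot.mkAlgHom k (FRel k))]
  exact RingQuot.mkAlgHom_rel k (FRel.arr_not_cover l m h)

theorem eP_mul_aP (l m : Ptn) : eP k l * aP k l m = aP k l m := by
  rw [eP, aP, ← map_mul]
  exact RingQuot.mkAlgHom_rel k (FRel.idem_arr l m)

theorem aP_mul_eP (l m : Ptn) : aP k l m * eP k m = aP k l m := by
  rw [eP, aP, ← map_mul]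
  exact RingQuot.mkAlgHom_rel k (FRel.arr_idem l m)

theorem aP_mul_aP_comm {l m n e : Ptn} (h1 : PCovers l m) (h2 : PCovers l n) (h3 : PCovers m e)
    (h4 : PCovers n e) (h : m ≠ n) : aP k l m * aP k m e = aP k l n * aP k n e := by
  simp only [aP, ← map_mul]
  exact RingQuot.mkAlgHom_rel k (FRel.square l m n e h1 h2 h3 h4 h)

theorem aP_mul_aP_of_sameColumn {l m e : Ptn} (h1 : PCovers l m) (h2 : PCovers m e)
    (h : SameColumn l e) : aP k l m * aP k m e = 0 := by
  rw [aP, aP, ← map_mul, ← map_zero (RingQuot.mkAlgHom k (FRel k))]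
  exact RingQuot.mkAlgHom_rel k (FRel.column l m e h1 h2 h)

theorem aP_mul_eP_of_ne {l m n : Ptn} (h : n ≠ m) : aP k l m * eP k n = 0 := by
  rw [← aP_mul_eP, mul_assoc, eP_mul_eP_of_ne h.symm, mul_zero]

theorem eP_mul_prodAlong (l : Ptn) (p : List Ptn) :
    eP k l * prodAlong k l p = prodAlong k l p := by
  cases p with
  | nil => exact eP_mul_self l
  | cons n p => rw [prodAlong, ← mul_assoc, eP_mul_aP]

theorem eP_mul_prodAlong_of_ne {l n : Ptn} (h : n ≠ l) (p : List Ptn) :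
    eP k n * prodAlong k l p = 0 := by
  rw [← eP_mul_prodAlong, ← mul_assoc, eP_mul_eP_of_ne h, zero_mul]

theorem prodAlong_append {l m : Ptn} {p : List Ptn} (hp : IsPath l m p) (q : List Ptn) :
    prodAlong k l (p ++ q) = prodAlong k l p * prodAlong k m q := by
  induction p generalizing l with
  | nil =>
    rw [isPath_nil] at hp
    rw [hp, prodAlong, List.nil_append, eP_mul_prodAlong]
  | cons n p ih =>
    rw [isPath_cons] at hp
    rw [List.cons_append, prodAlong, prodAlong, ih hp.2, mul_assoc]

theorem prodAlong_mul_eP {l m : Ptn} {p : List Ptn} (hp : IsPath l m p) :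
    prodAlong k l p * eP k m = prodAlong k l p := by
  have := prodAlong_append (k := k) hp []
  rwa [List.append_nil, prodAlong, eq_comm] at this

theorem prodAlong_eq_of_isPath {l m : Ptn} (h : Interlaced l m) {p q : List Ptn}
    (hp : IsPath l m p) (hq : IsPath l m q) : prodAlong k l p = prodAlong k l q := by
  induction hN : p.length generalizing l p q with
  | zero =>
    have := hp.length_eq hq
    rw [List.length_eq_zero_iff.1 hN, List.length_eq_zero_iff.1 (by omega : q.length = 0)]
  | succ N ih =>
    have hlen := hp.length_eq hq
    obtain ⟨n, p, rfl⟩ := List.exists_cons_of_length_eq_add_one hN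
    obtain ⟨n', q, rfl⟩ := List.exists_cons_of_length_eq_add_one (hlen ▸ hN)
    rw [isPath_cons] at hp hq
    simp only [List.length_cons] at hN hlen
    have hn := h.right_of_le hp.1.1 hp.2.le
    have hn' := h.right_of_le hq.1.1 hq.2.le
    rw [prodAlong, prodAlong]
    by_cases hne : n = n'
    · subst hne
      rw [ih hn hp.2 hq.2 (by omega)]
    · obtain ⟨e, he, he', hle⟩ := exists_diamond hp.1 hq.1 hne hp.2.le hq.2.le
      obtain ⟨s, hs⟩ := (hn.right_of_le he.1 hle).exists_isPath
      rw [ih hn hp.2 (isPath_cons.2 ⟨he, hs⟩) (by omega),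
        ih hn' hq.2 (isPath_cons.2 ⟨he', hs⟩) (by omega), prodAlong, prodAlong,
        ← mul_assoc, ← mul_assoc, aP_mul_aP_comm hp.1 hq.1 he he' hne]

theorem prodAlong_eq_zero {l m : Ptn} (h : ¬ Interlaced l m) {p : List Ptn}
    (hp : IsPath l m p) : prodAlong k l p = 0 := by
  induction hN : p.length generalizing l p with
  | zero =>
    rw [List.length_eq_zero_iff.1 hN, isPath_nil] at hp
    exact absurd (hp ▸ Interlaced.refl l) h
  | succ N ih =>
    obtain ⟨n, p, rfl⟩ := List.exists_cons_of_length_eq_add_one hN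
    have hle := hp.le
    rw [isPath_cons] at hp
    simp only [List.length_cons] at hN
    rw [prodAlong]
    by_cases hn : Interlaced n m
    swap
    · rw [ih hn hp.2 (by omega), mul_zero]
    obtain ⟨i, hi⟩ : ∃ i, l.1 i < m.1 (i + 1) := by
      by_contra! hcon
      exact h fun i => ⟨hle i, hcon i⟩
    obtain ⟨j, hj, hrj⟩ := pCovers_iff.1 hp.1
    have hni := (hn i).2
    have hij : i = j := by
      by_contra hij
      have := hrj i hij
      omega
    subst hij
    have hl := l.2 i
    have hn1 := hrj (i + 1) (by omega)
    obtain ⟨e, ⟨he1, hre⟩, he, hem⟩ := hn.exists_step (i := i + 1) (by omega)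
    obtain ⟨s, hs⟩ := hem.exists_isPath
    rw [prodAlong_eq_of_isPath hn hp.2 (isPath_cons.2 ⟨he, hs⟩), prodAlong, ← mul_assoc]
    rcases hl.eq_or_lt with heq | hlt
    · rw [aP_mul_aP_of_sameColumn hp.1 he, zero_mul]
      refine ⟨i, ?_, ?_, heq.symm, fun r h1 h2 => ?_⟩
      · rw [hre i (by omega), hj]
      · rw [he1, hn1]
      · rw [hre r h2, hrj r h1]
    · obtain ⟨n', hn', hrn'⟩ := exists_addBox l (i + 1) (fun r hr => by
        obtain rfl : i = r := by omega
        exact hlt)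
      have hln' : PCovers l n' := pCovers_iff.2 ⟨_, hn', hrn'⟩
      have hn'e : PCovers n' e := by
        refine pCovers_iff.2 ⟨i, ?_, fun r hr => ?_⟩
        · rw [hre i (by omega), hj, hrn' i (by omega)]
        · by_cases hr' : r = i + 1
          · rw [hr', he1, hn', hn1]
          · rw [hre r hr', hrj r hr, hrn' r hr']
      have hne : n ≠ n' := by
        rintro rfl
        omega
      have hni' : ¬ Interlaced n' m := fun hcon => by
        have h1 := (hcon i).2
        have h2 := hrn' i (by omega)
        omega
      have hlen := hp.2.length_eq (isPath_cons.2 ⟨he, hs⟩)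
      rw [List.length_cons] at hlen
      have hz := ih hni' (isPath_cons.2 ⟨hn'e, hs⟩) (by rw [List.length_cons]; omega)
      rw [prodAlong] at hz
      rw [aP_mul_aP_comm hp.1 hln' he hn'e hne, mul_assoc, hz, mul_zero]

variable (k) in
/-- The element `(λ‖μ)` of `F`: the product of the arrows along a directed path from `λ` to
`μ`, for `λ` interlaced under `μ`. -/
noncomputable def interlacedElt (x : {lm : Ptn × Ptn // Interlaced lm.1 lm.2}) : FAlg k :=
  prodAlong k x.1.1 x.2.exists_isPath.choose

theorem interlacedElt_eq_prodAlong (x : {lm : Ptn × Ptn // Interlaced lm.1 lm.2})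
    {p : List Ptn} (hp : IsPath x.1.1 x.1.2 p) : interlacedElt k x = prodAlong k x.1.1 p :=
  prodAlong_eq_of_isPath x.2 x.2.exists_isPath.choose_spec hp

theorem interlacedElt_mul {l m e : Ptn} (h1 : Interlaced l m) (h2 : Interlaced m e)
    (h3 : Interlaced l e) :
    interlacedElt k ⟨(l, m), h1⟩ * interlacedElt k ⟨(m, e), h2⟩ =
      interlacedElt k ⟨(l, e), h3⟩ := by
  obtain ⟨p, hp⟩ := h1.exists_isPath
  obtain ⟨q, hq⟩ := h2.exists_isPath
  rw [interlacedElt_eq_prodAlong _ hp, interlacedElt_eq_prodAlong _ hq,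
    interlacedElt_eq_prodAlong _ (hp.append hq), prodAlong_append hp]

theorem interlacedElt_self (l : Ptn) :
    interlacedElt k ⟨(l, l), Interlaced.refl l⟩ = eP k l :=
  interlacedElt_eq_prodAlong _ (isPath_nil.2 rfl)

theorem prodAlong_mem_span {l m : Ptn} {p : List Ptn} (hp : IsPath l m p) :
    prodAlong k l p ∈ Submodule.span k (Set.range (interlacedElt k)) := by
  by_cases h : Interlaced l m
  · exact Submodule.subset_span ⟨⟨(l, m), h⟩, interlacedElt_eq_prodAlong _ hp⟩
  · rw [prodAlong_eq_zero h hp]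
    exact zero_mem _

theorem mul_mem_span_interlacedElt (x : FAlg k) {y : FAlg k}
    (hy : y ∈ Submodule.span k (Set.range (interlacedElt k))) :
    x * y ∈ Submodule.span k (Set.range (interlacedElt k)) := by
  obtain ⟨a, rfl⟩ := RingQuot.mkAlgHom_surjective k (FRel k) x
  induction a using FreeAlgebra.induction generalizing y with
  | grade0 r =>
    rw [AlgHom.commutes, ← Algebra.smul_def]
    exact Submodule.smul_mem _ _ hy
  | grade1 g =>
    induction hy using Submodule.span_induction with
    | zero => rw [mul_zero]; exact zero_mem _
    | add u v _ _ hu hv => rw [mul_add]; exact add_mem hu hv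
    | smul c u _ hu => rw [mul_smul_comm]; exact Submodule.smul_mem _ _ hu
    | mem u hu =>
      obtain ⟨⟨⟨l, m⟩, h⟩, rfl⟩ := hu
      obtain ⟨p, hp⟩ := h.exists_isPath
      rw [interlacedElt_eq_prodAlong _ hp]
      cases g with
      | idem n =>
        change eP k n * prodAlong k l p ∈ _
        by_cases hn : n = l
        · rw [hn, eP_mul_prodAlong]
          exact prodAlong_mem_span hp
        · rw [eP_mul_prodAlong_of_ne hn]
          exact zero_mem _
      | arr n n' =>
        change aP k n n' * prodAlong k l p ∈ _
        by_cases hc : PCovers n n'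
        · by_cases hn : l = n'
          · subst hn
            exact prodAlong_mem_span (isPath_cons.2 ⟨hc, hp⟩)
          · rw [← eP_mul_prodAlong, ← mul_assoc, aP_mul_eP_of_ne hn, zero_mul]
            exact zero_mem _
        · rw [aP_of_not_pCovers hc, zero_mul]
          exact zero_mem _
  | mul a b ha hb =>
    rw [map_mul, mul_assoc]
    exact ha (hb hy)
  | add a b ha hb =>
    rw [map_add, add_mul]
    exact add_mem (ha hy) (hb hy)

theorem span_range_interlacedElt :
    Submodule.span k (Set.range (interlacedElt k)) = ⨆ lm : Ptn × Ptn, Fspace k lm.1 lm.2 := by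
  apply le_antisymm
  · rw [Submodule.span_le]
    rintro _ ⟨⟨⟨l, m⟩, h⟩, rfl⟩
    refine Submodule.mem_iSup_of_mem (l, m) ⟨interlacedElt k ⟨(l, m), h⟩, ?_⟩
    obtain ⟨p, hp⟩ := h.exists_isPath
    rw [interlacedElt_eq_prodAlong _ hp]
    change eP k l * (prodAlong k l p * eP k m) = _
    rw [prodAlong_mul_eP hp, eP_mul_prodAlong]
  · refine iSup_le ?_
    rintro ⟨l, m⟩ _ ⟨x, rfl⟩
    change eP k l * (x * eP k m) ∈ _
    refine mul_mem_span_interlacedElt _ (mul_mem_span_interlacedElt _ ?_)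
    rw [← interlacedElt_self]
    exact Submodule.subset_span ⟨_, rfl⟩

open Classical in
variable (k) in
/-- The action of the generators of `F` on the space with basis the pairs of partitions: on a
pair `(λ, μ)` with `λ` interlaced under `μ`, an arrow `κ → λ` replaces `λ` by `κ` if `κ` is
still interlaced under `μ`, and gives zero otherwise. -/
noncomputable def genAction : FGen → Module.End k (Ptn × Ptn →₀ k)
  | .idem n => Finsupp.linearCombination k fun x => if x.1 = n then Finsupp.single x 1 else 0
  | .arr n n' => Finsupp.linearCombination k fun x =>
      if x.1 = n' ∧ PCovers n n' ∧ Interlaced n' x.2 ∧ Interlaced n x.2 then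
        Finsupp.single (n, x.2) 1 else 0

open Classical in
theorem genAction_idem_single (n l m : Ptn) :
    genAction k (.idem n) (Finsupp.single (l, m) 1) =
      if l = n then Finsupp.single (l, m) 1 else 0 := by
  simp [genAction]

open Classical in
theorem genAction_arr_single (n n' l m : Ptn) :
    genAction k (.arr n n') (Finsupp.single (l, m) 1) =
      if l = n' ∧ PCovers n n' ∧ Interlaced n' m ∧ Interlaced n m then
        Finsupp.single (n, m) 1 else 0 := by
  simp [genAction]

theorem lift_genAction_of_fRel ⦃x y : FreeAlgebra k FGen⦄ (h : FRel k x y) :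
    FreeAlgebra.lift k (genAction k) x = FreeAlgebra.lift k (genAction k) y := by
  classical
  refine Finsupp.lhom_ext' fun ⟨s, t⟩ => LinearMap.ext_ring ?_
  simp only [LinearMap.comp_apply, Finsupp.lsingle_apply]
  induction h with
  | square l m n e h1 h2 h3 h4 h =>
    simp only [map_mul, FreeAlgebra.lift_ι_apply, Module.End.mul_apply, genAction_arr_single]
    by_cases hs : s = e ∧ Interlaced e t ∧ Interlaced l t
    · have hm := hs.2.2.right_of_le h1.1 fun i => (h3.1 i).trans (hs.2.1 i).1
      have hn := hs.2.2.right_of_le h2.1 fun i => (h4.1 i).trans (hs.2.1 i).1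
      simp [hs, h1, h2, h3, h4, hm, hn, genAction_arr_single]
    · split_ifs <;> simp only [genAction_arr_single, map_zero] <;> split_ifs <;> tauto
  | column l m e h1 h2 h =>
    obtain ⟨i, -, h3, h4, -⟩ := h
    have hno : ¬ (Interlaced e t ∧ Interlaced l t) := fun hcon => by
      have := (hcon.1 (i + 1)).1
      have := (hcon.2 i).2
      omega
    simp only [map_mul, FreeAlgebra.lift_ι_apply, Module.End.mul_apply, genAction_arr_single,
      map_zero, LinearMap.zero_apply]
    split_ifs <;> simp only [genAction_arr_single, map_zero] <;> split_ifs <;> tauto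
  | _ =>
    simp only [map_mul, FreeAlgebra.lift_ι_apply, Module.End.mul_apply, genAction_arr_single,
      genAction_idem_single, map_zero, LinearMap.zero_apply]
    split_ifs <;> simp_all [genAction_arr_single, genAction_idem_single] <;> grind

variable (k) in
/-- The representation of `F` on the space with basis the pairs of partitions. -/
noncomputable def interlacedRep : FAlg k →ₐ[k] Module.End k (Ptn × Ptn →₀ k) :=
  RingQuot.liftAlgHom k ⟨FreeAlgebra.lift k (genAction k), lift_genAction_of_fRel⟩

theorem interlacedRep_eP (n : Ptn) : interlacedRep k (eP k n) = genAction k (.idem n) := by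
  rw [interlacedRep, eP, RingQuot.liftAlgHom_mkAlgHom_apply, FreeAlgebra.lift_ι_apply]

theorem interlacedRep_aP (n n' : Ptn) : interlacedRep k (aP k n n') = genAction k (.arr n n') := by
  rw [interlacedRep, aP, RingQuot.liftAlgHom_mkAlgHom_apply, FreeAlgebra.lift_ι_apply]

theorem interlacedRep_prodAlong {l m : Ptn} (h : Interlaced l m) {p : List Ptn}
    (hp : IsPath l m p) :
    interlacedRep k (prodAlong k l p) (Finsupp.single (m, m) 1) = Finsupp.single (l, m) 1 := by
  induction p generalizing l with
  | nil =>
    rw [isPath_nil] at hp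
    subst hp
    simp [prodAlong, interlacedRep_eP, genAction_idem_single]
  | cons n p ih =>
    rw [isPath_cons] at hp
    have hn := h.right_of_le hp.1.1 hp.2.le
    rw [prodAlong, map_mul, Module.End.mul_apply, ih hn hp.2, interlacedRep_aP,
      genAction_arr_single, if_pos ⟨rfl, hp.1, hn, h⟩]

open Classical in
theorem interlacedRep_interlacedElt {l m : Ptn} (h : Interlaced l m) (n : Ptn) :
    interlacedRep k (interlacedElt k ⟨(l, m), h⟩) (Finsupp.single (n, n) 1) =
      if n = m then Finsupp.single (l, m) 1 else 0 := by
  obtain ⟨p, hp⟩ := h.exists_isPath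
  rw [interlacedElt_eq_prodAlong _ hp]
  split_ifs with hn
  · rw [hn, interlacedRep_prodAlong h hp]
  · rw [← prodAlong_mul_eP hp, map_mul, Module.End.mul_apply, interlacedRep_eP,
      genAction_idem_single, if_neg hn, map_zero]

theorem linearIndependent_interlacedElt : LinearIndependent k (interlacedElt k) := by
  classical
  refine LinearIndependent.of_pairwise_dual_eq_zero_one _
    (fun x => Finsupp.lapply x.1 ∘ₗ
      LinearMap.applyₗ (Finsupp.single (x.1.2, x.1.2) (1 : k)) ∘ₗ
        (interlacedRep k).toLinearMap) ?_ ?_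
  · rintro ⟨⟨l, m⟩, h⟩ ⟨⟨l', m'⟩, h'⟩ hne
    simp only [LinearMap.comp_apply, AlgHom.toLinearMap_apply, LinearMap.applyₗ_apply_apply,
      interlacedRep_interlacedElt, Finsupp.lapply_apply]
    split_ifs with hm
    · rw [Finsupp.single_apply, if_neg]
      rintro heq
      exact hne (Subtype.ext heq.symm)
    · rfl
  · rintro ⟨⟨l, m⟩, h⟩
    simp [interlacedRep_interlacedElt]

end Algebra

/-- Lemma 2.7: whenever `λ` is interlaced under `μ`, there is a directed path in
`Γ` from `λ` to `μ` and the products of arrow generators along all such paths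
coincide in `F`; the resulting elements `(λ‖μ)` form a `K`-basis of (the
idempotented part of) `F`, and `(λ‖μ)·(μ‖η) = (λ‖η)` whenever all three pairs
are interlaced. -/
theorem F_basis (K : Type) [Field K] [CharZero K] :
    (∀ l m : Ptn, Interlaced l m → ∃ p : List Ptn, IsPath l m p) ∧
    (∀ l m : Ptn, Interlaced l m → ∀ p q : List Ptn,
      IsPath l m p → IsPath l m q → prodAlong K l p = prodAlong K l q) ∧
    (∃ b : {lm : Ptn × Ptn // Interlaced lm.1 lm.2} → FAlg K,
      (∀ x : {lm : Ptn × Ptn // Interlaced lm.1 lm.2}, ∀ p : List Ptn,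
        IsPath x.1.1 x.1.2 p → b x = prodAlong K x.1.1 p) ∧
      LinearIndependent K b ∧
      Submodule.span K (Set.range b) = (⨆ lm : Ptn × Ptn, Fspace K lm.1 lm.2) ∧
      (∀ (l m e : Ptn) (h1 : Interlaced l m) (h2 : Interlaced m e) (h3 : Interlaced l e),
        b ⟨(l, m), h1⟩ * b ⟨(m, e), h2⟩ = b ⟨(l, e), h3⟩)) := by
  refine ⟨fun l m h => h.exists_isPath,
    fun l m h p q hp hq => prodAlong_eq_of_isPath h hp hq, interlacedElt K,
    fun x p hp => interlacedElt_eq_prodAlong x hp, linearIndependent_interlacedElt,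
    span_range_interlacedElt, fun l m e h1 h2 h3 => interlacedElt_mul h1 h2 h3⟩
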